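/- arXiv:math/0412078 — 4 statements merged into one kernel-verified Lean document; each statement's English description precedes it below -/
import Mathlib

section
/- Let w be a word (a finite list of positive integers) and let w' be obtained from w by a single transposition, i.e. w = a ++ [i, j] ++ b and w' = a ++ [j, i] ++ b for some words a, b and letters i, j with |i − j| ≥ 2. Then for every integer m ≥ 2, the m-pulse of w' equals the m-pulse of w: p_m(w') = p_m(w). -/
/-- A word is a finite list of positive integers.  `IsTransposition v w` says that `w` is
obtained from `v` by a single transposition of two adjacent letters `i j` with `|i - j| ≥ 2`. -/
def IsTransposition (v w : List ℕ+) : Prop :=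
  ∃ (a b : List ℕ+) (i j : ℕ+), 2 ≤ |(i : ℤ) - (j : ℤ)| ∧
    v = a ++ [i, j] ++ b ∧ w = a ++ [j, i] ++ b

/-- Two words are chord-equivalent if they are related by the equivalence relation generated
by transpositions. -/
def ChordEquiv : List ℕ+ → List ℕ+ → Prop := Relation.EqvGen IsTransposition

/-- `u` is an `m`-admissible subword pattern: its first and last letters equal `1`, consecutive
letters differ by at most `1`, and between any two successive occurrences of `1` there is
exactly one occurrence of `m`. -/
def IsAdmissible (m : ℕ+) (u : List ℕ+) : Prop :=
  u.head? = some 1 ∧ u.getLast? = some 1 ∧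
  u.Chain' (fun a b => |(a : ℤ) - (b : ℤ)| ≤ 1) ∧
  ∀ x y z : List ℕ+, u = x ++ 1 :: (y ++ 1 :: z) → (1 : ℕ+) ∉ y → y.count m = 1

/-- The `m`-pulse of a word `w`: the maximal number of occurrences of `m` in an `m`-admissible
subword (subsequence) of `w`, and `0` if there is no such subword. -/
noncomputable def pulse (m : ℕ+) (w : List ℕ+) : ℕ :=
  sSup {k : ℕ | ∃ u : List ℕ+, u.Sublist w ∧ IsAdmissible m u ∧ u.count m = k}

/-- The chain condition of `IsAdmissible` elaborates to one on the list of integer casts; it is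
equivalent to the condition on the word itself. -/
theorem chain_of_isAdmissible (m : ℕ+) (u : List ℕ+) (h : IsAdmissible m u) :
    u.IsChain (fun a b : ℕ+ => |(a : ℤ) - (b : ℤ)| ≤ 1) := by
  have h' : List.IsChain (fun a b : ℤ => |a - b| ≤ 1) (u.map (fun a : ℕ+ => (a : ℤ))) := by
    have e : (u.map (fun a : ℕ+ => (a : ℤ))) = u.flatMap (fun a : ℕ+ => [(a : ℤ)]) := by
      rw [List.map_eq_flatMap]
    rw [e]
    exact h.2.2.1
  exact (List.isChain_map _).1 h'

theorem sublist_swap_of_chain (a b u : List ℕ+) (i j : ℕ+)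
    (hij : 2 ≤ |(i : ℤ) - (j : ℤ)|) (hu : u.Sublist (a ++ [i, j] ++ b))
    (hc : u.IsChain (fun a b : ℕ+ => |(a : ℤ) - (b : ℤ)| ≤ 1)) :
    u.Sublist (a ++ [j, i] ++ b) := by
  obtain ⟨v, u3, rfl, hv, h3⟩ := List.sublist_append_iff.1 hu
  obtain ⟨u1, u2, rfl, h1, h2⟩ := List.sublist_append_iff.1 hv
  refine List.Sublist.append (List.Sublist.append h1 ?_) h3
  have h2c := (hc.left_of_append).right_of_append
  have hmem : u2 = [] ∨ u2 = [i] ∨ u2 = [j] ∨ u2 = [i, j] := by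
    have h : u2 ∈ [i, j].sublists' := List.mem_sublists'.2 h2
    simp [List.sublists'_cons, -List.mem_sublists'] at h
    tauto
  rcases hmem with rfl | rfl | rfl | rfl
  · simp
  · simp
  · simp
  · simp at h2c
    omega

/-- A single transposition preserves the `m`-pulse: if `w = a ++ [i, j] ++ b` and
`w' = a ++ [j, i] ++ b` with `|i - j| ≥ 2`, then `p_m(w') = p_m(w)` for every `m ≥ 2`. -/
theorem pulse_eq_of_transposition (a b : List ℕ+) (i j : ℕ+)
    (hij : 2 ≤ |(i : ℤ) - (j : ℤ)|) (m : ℕ+) (hm : 2 ≤ m) :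
    pulse m (a ++ [j, i] ++ b) = pulse m (a ++ [i, j] ++ b) := by
  unfold pulse
  congr 1
  ext k
  constructor
  · rintro ⟨u, hu, hA, hk⟩
    exact ⟨u, sublist_swap_of_chain a b u j i (by rwa [abs_sub_comm]) hu (chain_of_isAdmissible m u hA), hA, hk⟩
  · rintro ⟨u, hu, hA, hk⟩
    exact ⟨u, sublist_swap_of_chain a b u i j hij hu (chain_of_isAdmissible m u hA), hA, hk⟩
end

section
/- (Lemma 5 of the paper.) Suppose two words v and w represent the same chord, i.e. v and w are chord-equivalent. Then for every integer m ≥ 2, the m-pulse of v equals the m-pulse of w: p_m(v) = p_m(w). Consequently the m-pulse descends to a well-defined function on chords. -/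
theorem sublist_transpose (a b u : List ℕ+) (i j : ℕ+) (hij : 2 ≤ |(i : ℤ) - (j : ℤ)|)
    (hu : u.Sublist (a ++ [i, j] ++ b))
    (hc : List.IsChain (fun a b : ℕ+ => |(a : ℤ) - (b : ℤ)| ≤ 1) u) :
    u.Sublist (a ++ [j, i] ++ b) := by
  obtain ⟨u', u2, rfl, h', h2⟩ := List.sublist_append_iff.1 hu
  obtain ⟨u1, s, rfl, h1, hs⟩ := List.sublist_append_iff.1 h'
  refine List.Sublist.append (List.Sublist.append h1 ?_) h2
  have hcs : List.IsChain (fun a b : ℕ+ => |(a : ℤ) - (b : ℤ)| ≤ 1) s :=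
    (List.isChain_append.1 (List.isChain_append.1 hc).1).2.1
  have hmem : s ∈ List.sublists' [i, j] := List.mem_sublists'.2 hs
  simp only [List.sublists'_cons, List.sublists'_nil, List.map_cons, List.map_nil,
    List.cons_append, List.nil_append, List.mem_cons, List.not_mem_nil, or_false] at hmem
  rcases hmem with rfl | rfl | rfl | rfl
  · simp
  · simp
  · simp
  · simp at hcs
    omega

/-- The chain condition of an admissible word, read on the word itself. -/
theorem chain_of_admissible {m : ℕ+} {u : List ℕ+} (h : IsAdmissible m u) :
    List.IsChain (fun a b : ℕ+ => |(a : ℤ) - (b : ℤ)| ≤ 1) u := by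
  have hc := h.2.2.1
  have key : ∀ l : List ℕ+, (do let a ← l; pure ((a : ℕ) : ℤ)) = l.map (fun a : ℕ+ => ((a : ℕ) : ℤ)) := by
    intro l
    exact List.flatMap_pure_eq_map _ l
  rw [key] at hc
  exact (List.isChain_map _).1 hc

theorem pulse_eq_of_transposition_s1 (v w : List ℕ+) (h : IsTransposition v w) (m : ℕ+) :
    pulse m v = pulse m w := by
  obtain ⟨a, b, i, j, hij, rfl, rfl⟩ := h
  unfold pulse
  congr 1
  ext k
  constructor
  · rintro ⟨u, hu, ha, hk⟩
    exact ⟨u, sublist_transpose a b u i j hij hu (chain_of_admissible ha), ha, hk⟩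
  · rintro ⟨u, hu, ha, hk⟩
    exact ⟨u, sublist_transpose a b u j i (by rwa [abs_sub_comm]) hu (chain_of_admissible ha), ha, hk⟩

/-- Lemma 5 of the paper: if `v` and `w` represent the same chord (are chord-equivalent),
then `p_m(v) = p_m(w)` for every `m ≥ 2`; hence the `m`-pulse descends to a well-defined
function on chords. -/
theorem pulse_eq_of_chordEquiv (v w : List ℕ+) (hvw : ChordEquiv v w)
    (m : ℕ+) (hm : 2 ≤ m) : pulse m v = pulse m w := by
  unfold ChordEquiv at hvw
  induction hvw with
  | rel x y h => exact pulse_eq_of_transposition_s1 x y h m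
  | refl x => rfl
  | symm x y _ ih => exact ih.symm
  | trans x y z _ _ h1 h2 => exact h1.trans h2
end

section
/- For every word w and every integer m ≥ 2, the (m+1)-pulse of w is at most the m-pulse of w: p_{m+1}(w) ≤ p_m(w). (In the paper's phrasing: for each 2 ≤ m, the (m+1)-pulse of a chord is at most its m-pulse.) -/
/-- discrete intermediate value property for chains -/
theorem aux_ivt (m : ℕ+) : ∀ (l : List ℕ+) (c : ℕ+),
    (c :: l).IsChain (fun a b : ℕ+ => |(a : ℤ) - (b : ℤ)| ≤ 1) → c < m →
    (∃ x ∈ l, m ≤ x) → m ∈ l := by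
  intro l
  induction l with
  | nil => intro c _ _ h; simp at h
  | cons d l ih =>
    intro c hc hcm ⟨x, hx, hmx⟩
    rw [List.isChain_cons_cons] at hc
    obtain ⟨h1, h2⟩ := hc
    rcases lt_trichotomy d m with h | h | h
    · refine List.mem_cons_of_mem _ (ih d h2 h ⟨x, ?_, hmx⟩)
      rcases List.mem_cons.1 hx with rfl | hx
      · exact absurd hmx (not_le.2 h)
      · exact hx
    · simp [h]
    · exfalso
      rw [← PNat.coe_lt_coe] at h hcm
      rw [abs_le] at h1
      omega

/-- the reversed chain is a chain -/
theorem aux_rev {l : List ℕ+} (h : l.IsChain (fun a b : ℕ+ => |(a : ℤ) - (b : ℤ)| ≤ 1)) :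
    l.reverse.IsChain (fun a b : ℕ+ => |(a : ℤ) - (b : ℤ)| ≤ 1) := by
  rw [List.isChain_reverse]
  exact h.imp (fun a b hab => by rwa [abs_sub_comm])

/-- splitting at the first occurrence -/
theorem aux_split {m : ℕ+} : ∀ {l : List ℕ+}, m ∈ l → ∃ p q, l = p ++ m :: q ∧ m ∉ p := by
  intro l h
  obtain ⟨p, q, h1, h2⟩ := List.eq_append_cons_of_mem h
  exact ⟨p, q, h1, h2⟩

theorem aux_half (m : ℕ+) (hm : 2 ≤ m) (a : List ℕ+)
    (hc : (1 :: (a ++ [m + 1])).IsChain (fun a b : ℕ+ => |(a : ℤ) - (b : ℤ)| ≤ 1)) :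
    ∃ p, (p ++ [m]).Sublist a ∧ m ∉ p ∧
      (1 :: (p ++ [m])).IsChain (fun a b : ℕ+ => |(a : ℤ) - (b : ℤ)| ≤ 1) := by
  have h1 : (1 : ℕ+) < m := lt_of_lt_of_le (by decide) hm
  have hmm : m < m + 1 := PNat.lt_add_right m 1
  have h := aux_ivt m _ _ hc h1 ⟨m + 1, by simp, hmm.le⟩
  have h : m ∈ a := by
    rcases List.mem_append.1 h with h | h
    · exact h
    · exact absurd (List.mem_singleton.1 h) hmm.ne
  obtain ⟨p, q, rfl, hp⟩ := aux_split h
  refine ⟨p, by simp, hp, ?_⟩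
  apply hc.infix
  exact ⟨[], q ++ [m + 1], by simp⟩

theorem aux_seg (m : ℕ+) (hm : 2 ≤ m) (y : List ℕ+) (h1 : (1 : ℕ+) ∉ y)
    (hy : m + 1 ∈ y)
    (hc : (1 :: (y ++ [1])).IsChain (fun a b : ℕ+ => |(a : ℤ) - (b : ℤ)| ≤ 1)) :
    ∃ y', y'.Sublist y ∧ y'.count m = 1 ∧
      (1 :: (y' ++ [1])).IsChain (fun a b : ℕ+ => |(a : ℤ) - (b : ℤ)| ≤ 1) := by
  obtain ⟨a, b, rfl, -⟩ := aux_split hy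
  obtain ⟨p, hp, hmp, hcp⟩ := aux_half m hm a (hc.infix ⟨[], b ++ [1], by simp⟩)
  obtain ⟨q, hq, hmq, hcq⟩ := aux_half m hm b.reverse (by
    have := aux_rev hc
    exact this.infix ⟨[], a.reverse ++ [1], by simp⟩)
  have hq' := List.reverse_sublist.2 hq
  simp only [List.reverse_append, List.reverse_reverse, List.reverse_singleton,
    List.singleton_append] at hq'
  have hcq' := aux_rev hcq
  simp only [List.reverse_append, List.reverse_cons, List.reverse_nil, List.nil_append,
    List.singleton_append] at hcq'
  refine ⟨p ++ m :: q.reverse, ?_, ?_, ?_⟩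
  · have e : p ++ m :: q.reverse = (p ++ [m]) ++ q.reverse := by simp
    rw [e]
    exact hp.append (((List.sublist_cons_self _ _).trans hq').trans (List.sublist_cons_self _ _))
  · simp [List.count_eq_zero_of_not_mem, hmp, hmq]
  · have e : (1 : ℕ+) :: ((p ++ m :: q.reverse) ++ [1]) = (1 :: p) ++ m :: (q.reverse ++ [1]) := by
      simp
    rw [e, List.isChain_split]
    exact ⟨by simpa using hcp, by simpa using hcq'⟩

/-- uniqueness of splitting at the first 1 -/
theorem aux_uniq {p q : List ℕ+} : ∀ {y x : List ℕ+}, (1 : ℕ+) ∉ y →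
    x ++ 1 :: p = y ++ 1 :: q → ∃ x', x ++ [1] = y ++ 1 :: x' ∧ x' ++ p = q := by
  intro y
  induction y with
  | nil =>
    intro x _ h
    cases x with
    | nil => exact ⟨[], by simp_all⟩
    | cons c x => 
      simp at h
      exact ⟨x ++ [1], by simp [h.1], by simp [h.2]⟩
  | cons d y ih =>
    intro x hy h
    cases x with
    | nil => simp at h; simp [h.1] at hy
    | cons c x =>
      simp at h hy
      obtain ⟨x', h1, h2⟩ := ih hy.2 h.2
      exact ⟨x', by simp [h.1, h1], h2⟩

/-- The chain condition in `IsAdmissible` is elaborated on the list of integer casts; this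
restates it on the list itself. -/
theorem aux_adm (m : ℕ+) (u : List ℕ+) : IsAdmissible m u ↔
    (u.head? = some 1 ∧ u.getLast? = some 1 ∧
    u.IsChain (fun a b : ℕ+ => |(a : ℤ) - (b : ℤ)| ≤ 1) ∧
    ∀ x y z : List ℕ+, u = x ++ 1 :: (y ++ 1 :: z) → (1 : ℕ+) ∉ y → y.count m = 1) := by
  have e : ∀ l : List ℕ+, (do let a ← l; pure ((a : ℕ) : ℤ)) = List.map (fun a : ℕ+ => ((a : ℕ) : ℤ)) l := by
    intro l
    simp [List.map_eq_flatMap]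
  have e2 : List.IsChain (fun a b : ℤ => |a - b| ≤ 1) (do let a ← u; pure ((a : ℕ) : ℤ)) ↔
      u.IsChain (fun a b : ℕ+ => |(a : ℤ) - (b : ℤ)| ≤ 1) := by
    rw [e, List.isChain_map]
  rw [← e2]
  exact Iff.rfl

theorem aux_main (m : ℕ+) (hm : 2 ≤ m) : ∀ (n : ℕ) (u : List ℕ+), u.length ≤ n →
    IsAdmissible (m + 1) u →
    ∃ v, v.Sublist u ∧ IsAdmissible m v ∧ v.count m = u.count (m + 1) := by
  have hm1 : (1 : ℕ+) ≠ m := (lt_of_lt_of_le (by decide) hm).ne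
  have hm2 : (1 : ℕ+) ≠ m + 1 := (PNat.lt_add_left 1 m).ne
  intro n
  induction n with
  | zero =>
    intro u hu h
    have : u = [] := List.length_eq_zero_iff.1 (by omega)
    subst this
    simp [aux_adm] at h
  | succ n ih =>
    intro u hu hadm
    obtain ⟨hh, hl, hc, hs⟩ := (aux_adm _ _).1 hadm
    cases u with
    | nil => simp at hh
    | cons c t =>
    simp at hh
    subst hh
    by_cases h1 : (1 : ℕ+) ∈ t
    · obtain ⟨y, z, rfl, hy⟩ := aux_split h1
      have hcy := hs [] y z rfl hy
      have hu' : IsAdmissible (m + 1) (1 :: z) := by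
        refine (aux_adm _ _).2 ⟨rfl, ?_, ?_, ?_⟩
        · rw [← hl, ← List.cons_append, List.getLast?_append]
          simp [List.getLast?_cons]
        · exact List.IsChain.infix hc ⟨1 :: y, [], by simp⟩
        · intro x y' z' he
          exact hs (1 :: y ++ x) y' z' (by rw [he]; simp)
      obtain ⟨v, hv, hva, hvc⟩ := ih (1 :: z) (by simp at hu ⊢; omega) hu'
      obtain ⟨vh, vl, vc, vs⟩ := (aux_adm _ _).1 hva
      clear hva
      obtain ⟨y', hy1, hy2, hy3⟩ := aux_seg m hm y hy
        (List.count_pos_iff.1 (by omega)) (List.IsChain.infix hc ⟨[], z, by simp⟩)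
      have hy4 : (1 : ℕ+) ∉ y' := fun h => hy (hy1.subset h)
      cases v with
      | nil => simp at vh
      | cons c v =>
      simp at vh
      subst vh
      refine ⟨1 :: (y' ++ 1 :: v), (hy1.append hv).cons_cons 1, (aux_adm _ _).2 ⟨rfl, ?_, ?_, ?_⟩, ?_⟩
      · rw [← vl, ← List.cons_append, List.getLast?_append]
        simp [List.getLast?_cons]
      · rw [← List.cons_append, List.isChain_split]
        exact ⟨hy3, vc⟩
      · intro x p q he hp
        cases x with
        | nil =>
          simp at he
          obtain ⟨x', e1, e2⟩ := aux_uniq hp he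
          have e3 := congrArg List.length e1
          obtain ⟨x'', e4, e5⟩ := aux_uniq hy4 he.symm
          have e6 := congrArg List.length e4
          simp at e3 e6
          have : x' = [] := List.length_eq_zero_iff.1 (by omega)
          subst this
          simp at e1
          rwa [← e1]
        | cons d x =>
          simp at he
          obtain ⟨x', e1, e2⟩ := aux_uniq hy4 he.2.symm
          rcases List.eq_nil_or_concat x' with rfl | ⟨r, s, rfl⟩
          · exact vs [] p q (by simp [← e2]) hp
          · have e3 : x ++ [1] = (y' ++ 1 :: r) ++ [s] := by simpa using e1
            obtain ⟨-, e4⟩ := List.append_inj' e3 rfl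
            simp at e4
            subst e4
            exact vs (1 :: r) p q (by simp [← e2]) hp
      · simp only [List.count_cons_of_ne hm1, List.count_cons_of_ne hm2, List.count_append] at hvc ⊢
        omega
    · have : t = [] := by
        by_contra hne
        apply h1
        rw [List.getLast?_cons_of_ne_nil hne] at hl
        exact List.mem_of_getLast? hl
      subst this
      refine ⟨[1], List.Sublist.refl _, (aux_adm _ _).2 ⟨rfl, rfl, List.isChain_singleton _, ?_⟩, ?_⟩
      · intro x y z he
        have := congrArg List.length he
        simp at this
        omega
      · simp only [List.count_cons_of_ne hm1, List.count_cons_of_ne hm2, List.count_nil]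

/-- For every word `w` and every `m ≥ 2`, the `(m+1)`-pulse of `w` is at most its `m`-pulse. -/
theorem pulse_succ_le (w : List ℕ+) (m : ℕ+) (hm : 2 ≤ m) :
    pulse (m + 1) w ≤ pulse m w := by
  apply csSup_le'
  rintro k ⟨u, hu, ha, rfl⟩
  obtain ⟨v, hv, hva, hvc⟩ := aux_main m hm u.length u le_rfl ha
  refine le_csSup ⟨w.length, ?_⟩ ⟨v, hv.trans hu, hva, hvc⟩
  rintro k ⟨u, hu, -, rfl⟩
  exact List.count_le_length.trans hu.length_le
end

section
/- Pulse is almost additive under concatenation: for all words v and w and every integer m ≥ 2, the m-pulse of the concatenation v ++ w is either p_m(v) + p_m(w) or p_m(v) + p_m(w) + 1; that is, p_m(v) + p_m(w) ≤ p_m(v ++ w) ≤ p_m(v) + p_m(w) + 1. -/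
theorem adm_iff_aux (m : ℕ+) (u : List ℕ+) : IsAdmissible m u ↔
    u.head? = some 1 ∧ u.getLast? = some 1 ∧
    u.IsChain (fun a b : ℕ+ => |((a : ℕ) : ℤ) - ((b : ℕ) : ℤ)| ≤ 1) ∧
    ∀ x y z : List ℕ+, u = x ++ 1 :: (y ++ 1 :: z) → (1 : ℕ+) ∉ y → y.count m = 1 := by
  have e : (do let a ← u; pure (((a : ℕ+) : ℕ) : ℤ)) = u.map (fun a : ℕ+ => ((a : ℕ) : ℤ)) := by
    rw [List.map_eq_flatMap]; rfl
  unfold IsAdmissible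
  rw [e]
  unfold List.Chain'
  rw [List.isChain_map]

theorem le_pulse_aux {m : ℕ+} {u w : List ℕ+} (h : u.Sublist w) (ha : IsAdmissible m u) :
    u.count m ≤ pulse m w := by
  refine le_csSup ⟨w.length, ?_⟩ ⟨u, h, ha, rfl⟩
  rintro k ⟨u, hu, -, rfl⟩
  exact List.count_le_length.trans hu.length_le

theorem pulse_cases_aux (m : ℕ+) (w : List ℕ+) :
    pulse m w = 0 ∨ ∃ u : List ℕ+, u.Sublist w ∧ IsAdmissible m u ∧ u.count m = pulse m w := by
  by_cases hne : {k : ℕ | ∃ u : List ℕ+, u.Sublist w ∧ IsAdmissible m u ∧ u.count m = k}.Nonempty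
  · right
    refine Nat.sSup_mem hne ⟨w.length, ?_⟩
    rintro k ⟨u, hu, -, rfl⟩
    exact List.count_le_length.trans hu.length_le
  · left
    rw [Set.not_nonempty_iff_eq_empty] at hne
    rw [pulse, hne]
    simp

theorem pulse_mono_aux (m : ℕ+) {v w : List ℕ+} (h : v.Sublist w) : pulse m v ≤ pulse m w := by
  rcases pulse_cases_aux m v with h0 | ⟨u, hu, ha, hc⟩
  · omega
  · rw [← hc]; exact le_pulse_aux (hu.trans h) ha

theorem adm_prefix_aux {m : ℕ+} {a r : List ℕ+} (h : IsAdmissible m (a ++ 1 :: r)) :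
    IsAdmissible m (a ++ [1]) := by
  obtain ⟨h1, h2, h3, h4⟩ := (adm_iff_aux _ _).1 h
  refine (adm_iff_aux _ _).2 ⟨?_, by simp, ?_, ?_⟩
  · cases a <;> simp_all
  · have : a ++ 1 :: r = (a ++ [1]) ++ r := by simp
    rw [this] at h3
    exact (List.isChain_append.1 h3).1
  · intro x y z he
    refine h4 x y (z ++ r) ?_
    have : a ++ 1 :: r = (a ++ [1]) ++ r := by simp
    rw [this, he]; simp

theorem adm_suffix_aux {m : ℕ+} {a r : List ℕ+} (h : IsAdmissible m (a ++ 1 :: r)) :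
    IsAdmissible m (1 :: r) := by
  obtain ⟨h1, h2, h3, h4⟩ := (adm_iff_aux _ _).1 h
  refine (adm_iff_aux _ _).2 ⟨by simp, ?_, (List.isChain_append.1 h3).2.1, ?_⟩
  · rw [List.getLast?_append] at h2
    cases hr : (1 :: r).getLast? <;> simp_all
  · intro x y z he
    refine h4 (a ++ x) y z ?_
    rw [he]; simp

theorem adm_glue_aux {m : ℕ+} {s t : List ℕ+} (h : IsAdmissible m (s ++ [1]))
    (h' : IsAdmissible m (1 :: t)) : IsAdmissible m (s ++ 1 :: t) := by
  obtain ⟨h1, h2, h3, h4⟩ := (adm_iff_aux _ _).1 h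
  obtain ⟨k1, k2, k3, k4⟩ := (adm_iff_aux _ _).1 h'
  refine (adm_iff_aux _ _).2 ⟨?_, ?_, ?_, ?_⟩
  · cases s <;> simp_all
  · rw [List.getLast?_append, k2]; simp
  · refine List.isChain_append.2 ⟨(List.isChain_append.1 h3).1, k3, ?_⟩
    intro x hx y hy
    exact (List.isChain_append.1 h3).2.2 x hx y (by simpa using hy)
  · intro x y z he hy
    rcases List.append_eq_append_iff.1 he with ⟨c, rfl, hc⟩ | ⟨c, rfl, hc⟩
    · exact k4 c y z hc hy
    · rcases c with _ | ⟨e, c⟩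
      · exact k4 [] y z (by simpa using hc.symm) hy
      · simp only [List.cons_append, List.cons.injEq] at hc
        obtain ⟨rfl, hc⟩ := hc
        rcases List.append_eq_append_iff.1 hc with ⟨d, rfl, hd⟩ | ⟨d, rfl, hd⟩
        · rcases d with _ | ⟨e, d⟩
          · exact h4 x y [] (by simp) hy
          · simp only [List.cons_append, List.cons.injEq] at hd
            obtain ⟨rfl, hd⟩ := hd
            exact h4 x y (d ++ [1]) (by simp) hy
        · rcases d with _ | ⟨e, d⟩
          · simpa using h4 x c [] (by simp) (by simpa using hy)
          · simp only [List.cons_append, List.cons.injEq] at hd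
            obtain ⟨rfl, hd⟩ := hd
            simp at hy

theorem first_one_aux (l : List ℕ+) (h : 1 ∈ l) : ∃ y r, l = y ++ 1 :: r ∧ (1 : ℕ+) ∉ y := by
  obtain ⟨y, r, h1, h2⟩ := List.eq_append_cons_of_mem h
  exact ⟨y, r, h1, h2⟩

theorem last_one_aux (l : List ℕ+) (h : 1 ∈ l) : ∃ y r, l = r ++ 1 :: y ∧ (1 : ℕ+) ∉ y := by
  obtain ⟨y, r, h1, h2⟩ := first_one_aux l.reverse (by simpa using h)
  refine ⟨y.reverse, r.reverse, ?_, by simpa using h2⟩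
  rw [← List.reverse_reverse l, h1]; simp

/-- Pulse is almost additive under concatenation: the `m`-pulse of `v ++ w` is either
`p_m(v) + p_m(w)` or `p_m(v) + p_m(w) + 1`. -/
theorem pulse_append (v w : List ℕ+) (m : ℕ+) (hm : 2 ≤ m) :
    pulse m v + pulse m w ≤ pulse m (v ++ w) ∧
      pulse m (v ++ w) ≤ pulse m v + pulse m w + 1 := by
  have hm1 : (1 : ℕ+) ≠ m := by
    rintro rfl
    exact absurd hm (by decide)
  constructor
  · rcases pulse_cases_aux m v with h0 | ⟨u, hu, ha, hc⟩
    · rw [h0, zero_add]; exact pulse_mono_aux m (List.sublist_append_right v w)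
    rcases pulse_cases_aux m w with h0 | ⟨u', hu', ha', hc'⟩
    · rw [h0, add_zero]; exact pulse_mono_aux m (List.sublist_append_left v w)
    obtain ⟨s, rfl⟩ : ∃ s, u = s ++ [1] := List.getLast?_eq_some_iff.1 ha.2.1
    obtain ⟨t, rfl⟩ : ∃ t, u' = 1 :: t := List.head?_eq_some_iff.1 ha'.1
    have hg := adm_glue_aux ha ha'
    have hs : (s ++ 1 :: t).Sublist (v ++ w) :=
      ((List.sublist_append_left s [1]).trans hu).append hu'
    have := le_pulse_aux hs hg
    rw [← hc, ← hc']
    simp [List.count_append, List.count_cons, hm1] at this ⊢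
    exact this
  · rcases pulse_cases_aux m (v ++ w) with h0 | ⟨u, hu, ha, hc⟩
    · omega
    obtain ⟨a, b, rfl, hav, hbw⟩ := List.sublist_append_iff.1 hu
    rcases List.eq_nil_or_concat a with rfl | hane
    · have := le_pulse_aux hbw ha
      rw [List.nil_append] at hc
      omega
    by_cases hb : b = []
    · subst hb
      rw [List.append_nil] at hc ha
      have := le_pulse_aux hav ha
      omega
    have h1a : 1 ∈ a := by
      have := ha.1
      cases a with
      | nil => simp at hane
      | cons e a => simp at this; simp [this]
    have h1b : 1 ∈ b := by
      have := ha.2.1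
      rw [List.getLast?_append_of_ne_nil _ hb] at this
      exact List.mem_of_getLast? this
    obtain ⟨y1, a', rfl, hy1⟩ := last_one_aux a h1a
    obtain ⟨y2, b', rfl, hy2⟩ := first_one_aux b h1b
    have hmid := ha.2.2.2 a' (y1 ++ y2) b' (by simp) (by simp [hy1, hy2])
    have e1 : a' ++ 1 :: y1 ++ (y2 ++ 1 :: b') = a' ++ 1 :: (y1 ++ (y2 ++ 1 :: b')) := by simp
    have e2 : a' ++ 1 :: y1 ++ (y2 ++ 1 :: b') = (a' ++ 1 :: (y1 ++ y2)) ++ 1 :: b' := by simp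
    have A1 := adm_prefix_aux (e1 ▸ ha)
    have A2 := adm_suffix_aux (e2 ▸ ha)
    have L1 := le_pulse_aux (List.Sublist.trans (by simp) hav) A1
    have L2 := le_pulse_aux ((List.sublist_append_right _ _).trans hbw) A2
    simp [List.count_append, List.count_cons, hm1] at L1 L2 hc hmid
    omega
end
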